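/- arXiv:1103.1521 — 2 statements merged into one kernel-verified Lean document; each statement's English description precedes it below -/
import Mathlib

section
/- Let d ≥ 4 and let G be a d-regular simple graph that contains no cycle of length 4 (as a subgraph), with vertex connectivity κ(G) ≤ (d+1)/2. Let U be a set of vertices with |U| = κ(G) such that G \ U is disconnected, and let G_1 be a connected component of G \ U. Then there exists a vertex a ∈ G_1 that has no neighbor in U. -/
open SimpleGraph

/-- A b-coloring of `G` with `k` colors: a proper coloring using all `k` colors in which
every color class contains a vertex adjacent to at least one vertex of each other color class. -/
def IsBColoring {V : Type*} (G : SimpleGraph V) (k : ℕ) (C : V → Fin k) : Prop :=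
  (∀ u v : V, G.Adj u v → C u ≠ C v) ∧
  ∀ c : Fin k, ∃ v : V, C v = c ∧ ∀ c' : Fin k, c' ≠ c → ∃ u : V, G.Adj v u ∧ C u = c'

/-- The b-chromatic number: the largest `k` such that `G` admits a b-coloring with `k` colors. -/
noncomputable def bChromaticNumber {V : Type*} (G : SimpleGraph V) : ℕ :=
  sSup {k : ℕ | ∃ C : V → Fin k, IsBColoring G k C}

/-- `G` contains no cycle of length 4. -/
def NoFourCycle {V : Type*} (G : SimpleGraph V) : Prop :=
  ∀ (v : V) (w : G.Walk v v), w.IsCycle → w.length ≠ 4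

/-- The vertex connectivity of `G`: the minimum size of a set `U` of vertices such that
`G \ U` is disconnected or has exactly one vertex. -/
noncomputable def vertexConnectivity {V : Type*} (G : SimpleGraph V) : ℕ :=
  sInf {k : ℕ | ∃ U : Set V, U.ncard = k ∧
    (¬ (G.induce Uᶜ).Preconnected ∨ (Uᶜ : Set V).ncard = 1)}

/-- In a graph without 4-cycles, two distinct vertices have at most one common neighbor. -/
lemma NoFourCycle.common_unique {V : Type*} {G : SimpleGraph V} (h4 : NoFourCycle G)
    {a u b b' : V} (hau : a ≠ u) (h1 : G.Adj a b) (h2 : G.Adj b u) (h3 : G.Adj a b')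
    (h4' : G.Adj b' u) : b = b' := by
  by_contra hbb
  refine h4 a (.cons h1 (.cons h2 (.cons h4'.symm (.cons h3.symm .nil)))) ?_ rfl
  have := h1.ne
  have := h2.ne
  have := h3.ne
  have := h4'.ne
  rw [Walk.isCycle_def]
  refine ⟨?_, by simp, ?_⟩
  · rw [Walk.isTrail_def]
    simp
    grind
  · simp
    grind

/-- Let `d ≥ 4`, `G` be `d`-regular with no 4-cycle and `κ(G) ≤ (d+1)/2`. If `U` is a
minimum vertex cut (so that `G \ U` is disconnected) and `G₁` is a connected component of
`G \ U`, then some vertex of `G₁` has no neighbor in `U`. -/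
theorem exists_vertex_no_neighbor_in_cut
    {V : Type*} [Fintype V] (G : SimpleGraph V) [DecidableRel G.Adj] (d : ℕ) (hd : 4 ≤ d)
    (hreg : G.IsRegularOfDegree d) (h4 : NoFourCycle G)
    (hconn : (vertexConnectivity G : ℝ) ≤ ((d : ℝ) + 1) / 2)
    (U : Set V) (hUcard : U.ncard = vertexConnectivity G)
    (hdisc : ¬ (G.induce Uᶜ).Preconnected)
    (G₁ : (G.induce Uᶜ).ConnectedComponent) :
    ∃ a : (Uᶜ : Set V), (G.induce Uᶜ).connectedComponentMk a = G₁ ∧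
      ∀ u ∈ U, ¬ G.Adj (a : V) u := by
  classical
  by_contra hcon
  push Not at hcon
  set k := U.ncard with hk
  have hk2 : 2 * k ≤ d + 1 := by
    rw [← hUcard] at hconn
    have : (2 * k : ℝ) ≤ d + 1 := by linarith
    exact_mod_cast this
  let f : V → ℕ := fun x => ((G.neighborFinset x).filter (· ∈ U)).card
  have hkU : k = U.toFinset.card := by rw [hk, Set.ncard_eq_toFinset_card']
  have hfle : ∀ x, f x ≤ k := by
    intro x
    rw [hkU]
    apply Finset.card_le_card
    intro y hy
    simp at hy ⊢
    exact hy.2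
  have hcount : ∀ x, f x + ((G.neighborFinset x).filter (· ∉ U)).card = d := by
    intro x
    have h := Finset.card_filter_add_card_filter_not (s := G.neighborFinset x) (· ∈ U)
    rw [G.card_neighborFinset_eq_degree, hreg x] at h
    exact h
  have hsum : ∀ x, x ∉ U → ∑ b ∈ (G.neighborFinset x).filter (· ∉ U), f b ≤ k := by
    intro x hx
    rw [hkU, ← Finset.card_biUnion]
    · apply Finset.card_le_card
      intro y hy
      simp at hy ⊢
      obtain ⟨_, _, _, h⟩ := hy
      exact h
    · intro b hb b' hb' hne
      rw [Function.onFun, Finset.disjoint_left]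
      intro u hu hu'
      simp at hb hb' hu hu'
      refine hne (h4.common_unique (u := u) ?_ hb.1 hu.1 hb'.1 hu'.1)
      rintro rfl
      exact hx hu.2
  let A : V → Prop := fun x => ∃ h : x ∈ Uᶜ, (G.induce Uᶜ).connectedComponentMk ⟨x, h⟩ = G₁
  have hstep : ∀ x y, A x → G.Adj x y → y ∉ U → A y := by
    rintro x y ⟨hx, hx'⟩ hxy hy
    refine ⟨hy, ?_⟩
    rw [← hx']
    apply ConnectedComponent.sound
    apply Adj.reachable
    simpa using hxy.symm
  have hpos : ∀ x, A x → 1 ≤ f x := by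
    rintro x ⟨hx, hx'⟩
    obtain ⟨u, hu, hxu⟩ := hcon ⟨x, hx⟩ hx'
    apply Finset.card_pos.2
    exact ⟨u, by simpa using ⟨hxu, hu⟩⟩
  have hbig : ∀ (m : ℕ) (x : V), A x → (∀ y, A y → m ≤ f y) → (d - f x) * m ≤ k := by
    intro m x hx hm
    refine le_trans ?_ (hsum x hx.1)
    rw [← hcount x, Nat.add_sub_cancel_left, ← smul_eq_mul]
    apply Finset.card_nsmul_le_sum
    intro y hy
    simp at hy
    exact hm y (hstep x y hx hy.1 hy.2)
  have h1 : ∀ x, A x → d - k ≤ f x := by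
    intro x hx
    have := hbig 1 x hx hpos
    omega
  obtain ⟨a, ha⟩ := G₁.exists_rep
  have hA : A a := ⟨a.2, ha⟩
  have h2 := hbig (d - k) a hA h1
  have h3 : d - k ≤ d - f a := by have := hfle a; omega
  have h5 : (d - k) * (d - k) ≤ k := le_trans (Nat.mul_le_mul_right _ h3) h2
  obtain ⟨m, hm⟩ : ∃ m, d = k + m := ⟨d - k, by omega⟩
  have hm' : d - k = m := by omega
  rw [hm'] at h5
  have h6 : 2 ≤ m := by omega
  nlinarith
end

section
/- The b-chromatic number of the Petersen graph is 3. -/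
open SimpleGraph

/-- The Petersen graph as the Kneser graph `K(5,2)`: vertices are the 2-element subsets of
a 5-element set, adjacent iff disjoint. -/
def petersenGraph : SimpleGraph {s : Finset (Fin 5) // s.card = 2} :=
  SimpleGraph.fromRel (fun a b => Disjoint a.val b.val)

/-- Explicit vertices of the Petersen graph: outer cycle `0..4`, inner cycle `5..9`. -/
def pvert : Fin 10 → {s : Finset (Fin 5) // s.card = 2} :=
  ![⟨{0,1}, by decide⟩, ⟨{2,3}, by decide⟩, ⟨{4,0}, by decide⟩, ⟨{1,2}, by decide⟩,
    ⟨{3,4}, by decide⟩, ⟨{2,4}, by decide⟩, ⟨{4,1}, by decide⟩, ⟨{1,3}, by decide⟩,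
    ⟨{3,0}, by decide⟩, ⟨{0,2}, by decide⟩]

def pn1 : Fin 10 → Fin 10 := ![1, 0, 1, 2, 0, 0, 1, 2, 3, 4]
def pn2 : Fin 10 → Fin 10 := ![4, 2, 3, 4, 3, 7, 8, 5, 5, 6]
def pn3 : Fin 10 → Fin 10 := ![5, 6, 7, 8, 9, 8, 9, 9, 6, 7]

instance : DecidableRel petersenGraph.Adj := fun a b =>
  inferInstanceAs (Decidable (a ≠ b ∧ (Disjoint a.val b.val ∨ Disjoint b.val a.val)))

lemma pvert_surj : ∀ v, ∃ i, pvert i = v := by decide +kernel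

lemma pvert_adj : ∀ i u, petersenGraph.Adj (pvert i) u →
    u = pvert (pn1 i) ∨ u = pvert (pn2 i) ∨ u = pvert (pn3 i) := by decide +kernel

lemma adj1 : ∀ i, petersenGraph.Adj (pvert i) (pvert (pn1 i)) ∧
    petersenGraph.Adj (pvert i) (pvert (pn2 i)) ∧
    petersenGraph.Adj (pvert i) (pvert (pn3 i)) := by decide +kernel

/-- A dominating vertex in a colouring sees all other colours on its three neighbours. -/
lemma dom_cover {k : ℕ} {C : {s : Finset (Fin 5) // s.card = 2} → Fin k}
    (h : IsBColoring petersenGraph k C) (c : Fin k) :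
    ∃ i, C (pvert i) = c ∧ (Finset.univ : Finset (Fin k)) ⊆
      {C (pvert i), C (pvert (pn1 i)), C (pvert (pn2 i)), C (pvert (pn3 i))} := by
  obtain ⟨v, hv, hd⟩ := h.2 c
  obtain ⟨i, rfl⟩ := pvert_surj v
  refine ⟨i, hv, fun c' _ => ?_⟩
  by_cases hc : c' = c
  · simp [hc, hv]
  · obtain ⟨u, hu, rfl⟩ := hd c' hc
    rcases pvert_adj i u hu with rfl | rfl | rfl <;> simp

lemma four_distinct : ∀ a b c d : Fin 4, Finset.univ ⊆ ({a, b, c, d} : Finset (Fin 4)) →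
    b ≠ c ∧ b ≠ d ∧ c ≠ d := by decide +kernel

set_option synthInstance.maxHeartbeats 2000000 in
set_option synthInstance.maxSize 100000 in
set_option maxRecDepth 100000 in
set_option maxHeartbeats 4000000 in
/-- The finite search: no proper 4-colouring has a rainbow vertex in every class. -/
lemma no_four_search : ∀ x0 : Fin 4, x0 = 0 → ∀ x1 : Fin 4, x1 = 1 → ∀ x2 : Fin 4, x1 ≠ x2 → ∀ x3, x2 ≠ x3 →
    ∀ x4, x3 ≠ x4 → x0 ≠ x4 → ∀ x5, x0 ≠ x5 → ∀ x6, x1 ≠ x6 →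
    ∀ x7, x2 ≠ x7 → x5 ≠ x7 → ∀ x8, x3 ≠ x8 → x5 ≠ x8 → x6 ≠ x8 →
    ∀ x9, x4 ≠ x9 → x6 ≠ x9 → x7 ≠ x9 →
    ¬ ∀ c : Fin 4,
      (x0 = c ∧ x1 ≠ x4 ∧ x1 ≠ x5 ∧ x4 ≠ x5) ∨
      (x1 = c ∧ x0 ≠ x2 ∧ x0 ≠ x6 ∧ x2 ≠ x6) ∨
      (x2 = c ∧ x1 ≠ x3 ∧ x1 ≠ x7 ∧ x3 ≠ x7) ∨
      (x3 = c ∧ x2 ≠ x4 ∧ x2 ≠ x8 ∧ x4 ≠ x8) ∨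
      (x4 = c ∧ x0 ≠ x3 ∧ x0 ≠ x9 ∧ x3 ≠ x9) ∨
      (x5 = c ∧ x0 ≠ x7 ∧ x0 ≠ x8 ∧ x7 ≠ x8) ∨
      (x6 = c ∧ x1 ≠ x8 ∧ x1 ≠ x9 ∧ x8 ≠ x9) ∨
      (x7 = c ∧ x2 ≠ x5 ∧ x2 ≠ x9 ∧ x5 ≠ x9) ∨
      (x8 = c ∧ x3 ≠ x5 ∧ x3 ≠ x6 ∧ x5 ≠ x6) ∨
      (x9 = c ∧ x4 ≠ x6 ∧ x4 ≠ x7 ∧ x6 ≠ x7) := by decide +kernel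

lemma no_four_normalized (C : {s : Finset (Fin 5) // s.card = 2} → Fin 4)
    (h0 : C (pvert 0) = 0) (h1 : C (pvert 1) = 1) :
    ¬ IsBColoring petersenGraph 4 C := by
  intro h
  have p : ∀ i, C (pvert i) ≠ C (pvert (pn1 i)) ∧ C (pvert i) ≠ C (pvert (pn2 i)) ∧
      C (pvert i) ≠ C (pvert (pn3 i)) := fun i =>
    ⟨h.1 _ _ (adj1 i).1, h.1 _ _ (adj1 i).2.1, h.1 _ _ (adj1 i).2.2⟩
  refine no_four_search (C (pvert 0)) h0 (C (pvert 1)) h1 (C (pvert 2)) (p 1).2.1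
    (C (pvert 3)) (p 2).2.1 (C (pvert 4)) (p 3).2.1 (p 0).2.1 (C (pvert 5)) (p 0).2.2
    (C (pvert 6)) (p 1).2.2 (C (pvert 7)) (p 2).2.2 (p 5).2.1 (C (pvert 8)) (p 3).2.2
    (p 5).2.2 (p 6).2.1 (C (pvert 9)) (p 4).2.2 (p 6).2.2 (p 7).2.2 ?_
  intro c
  obtain ⟨i, hi, hs⟩ := dom_cover h c
  have hd := four_distinct _ _ _ _ hs
  clear hs p h
  fin_cases i
  · exact Or.inl ⟨hi, hd⟩
  · exact Or.inr <| Or.inl ⟨hi, hd⟩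
  · exact Or.inr <| Or.inr <| Or.inl ⟨hi, hd⟩
  · exact Or.inr <| Or.inr <| Or.inr <| Or.inl ⟨hi, hd⟩
  · exact Or.inr <| Or.inr <| Or.inr <| Or.inr <| Or.inl ⟨hi, hd⟩
  · exact Or.inr <| Or.inr <| Or.inr <| Or.inr <| Or.inr <| Or.inl ⟨hi, hd⟩
  · exact Or.inr <| Or.inr <| Or.inr <| Or.inr <| Or.inr <| Or.inr <| Or.inl ⟨hi, hd⟩
  · exact Or.inr <| Or.inr <| Or.inr <| Or.inr <| Or.inr <| Or.inr <| Or.inr <| Or.inl ⟨hi, hd⟩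
  · exact Or.inr <| Or.inr <| Or.inr <| Or.inr <| Or.inr <| Or.inr <| Or.inr <| Or.inr <|
      Or.inl ⟨hi, hd⟩
  · exact Or.inr <| Or.inr <| Or.inr <| Or.inr <| Or.inr <| Or.inr <| Or.inr <| Or.inr <|
      Or.inr ⟨hi, hd⟩

lemma exists_perm : ∀ a b : Fin 4, a ≠ b → ∃ σ : Equiv.Perm (Fin 4), σ a = 0 ∧ σ b = 1 := by
  decide +kernel

/-- Renaming the colours keeps a b-colouring. -/
lemma isB_perm {k : ℕ} {C : {s : Finset (Fin 5) // s.card = 2} → Fin k}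
    (h : IsBColoring petersenGraph k C) (σ : Equiv.Perm (Fin k)) :
    IsBColoring petersenGraph k (fun v => σ (C v)) := by
  refine ⟨fun u v huv he => h.1 u v huv (σ.injective he), fun c => ?_⟩
  obtain ⟨v, hv, hd⟩ := h.2 (σ.symm c)
  refine ⟨v, by simp [hv], fun d hdc => ?_⟩
  obtain ⟨u, hu, hud⟩ := hd (σ.symm d) (fun he => hdc (σ.symm.injective he))
  exact ⟨u, hu, by simp [hud]⟩

lemma no_four (C : {s : Finset (Fin 5) // s.card = 2} → Fin 4) :
    ¬ IsBColoring petersenGraph 4 C := by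
  intro h
  obtain ⟨σ, h0, h1⟩ := exists_perm _ _ (h.1 _ _ (adj1 0).1)
  exact no_four_normalized _ h0 h1 (isB_perm h σ)

/-- A b-colouring with three colours. -/
def pcol (s : {s : Finset (Fin 5) // s.card = 2}) : Fin 3 :=
  if 0 ∈ s.val then 0 else if 2 ∈ s.val then 1 else 2

lemma pcol_isB : IsBColoring petersenGraph 3 pcol := by
  unfold IsBColoring
  decide +kernel

/-- The b-chromatic number of the Petersen graph is 3. -/
theorem bChromatic_petersen : bChromaticNumber petersenGraph = 3 := by
  refine IsGreatest.csSup_eq ⟨⟨pcol, pcol_isB⟩, ?_⟩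
  rintro k ⟨C, h⟩
  by_contra hk
  have hk : 3 < k := not_le.mp hk
  obtain ⟨i, -, hs⟩ := dom_cover h ⟨0, by omega⟩
  have h4 := (Finset.card_le_card hs).trans Finset.card_le_four
  rw [Finset.card_univ, Fintype.card_fin] at h4
  obtain rfl : k = 4 := by omega
  exact no_four C h
end
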